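/- Let n ≥ 1 be an integer and let f and g be normalized parabolic germs of multiplicity n + 1. Then there exist an attracting petal P_g of g, an attracting petal P_f of f, and a bijective holomorphic map ψ : P_g → P_f such that f(ψ(z)) = ψ(g(z)) for all z ∈ P_g. -/

import Mathlib

open Filter Topology Asymptotics

/-- An attracting petal of `f` in a neighborhood `N` of `0`: a nonempty simply
connected open set `P ⊆ N ∩ f(N)` with `f(P) ⊆ P`, `0 ∈ closure P`, `0 ∉ P`,
on which the iterates of `f` converge uniformly to `0`. -/
def IsAttractingPetal (f : ℂ → ℂ) (N P : Set ℂ) : Prop :=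
  P.Nonempty ∧ IsOpen P ∧ SimplyConnectedSpace P ∧
  P ⊆ N ∩ (f '' N) ∧ f '' P ⊆ P ∧
  (0 : ℂ) ∈ closure P ∧ (0 : ℂ) ∉ P ∧
  TendstoUniformlyOn (fun (m : ℕ) (z : ℂ) => f^[m] z) (fun _ => 0) atTop P

/-- A holomorphic function on a right half-plane bounded by `C (Re w) ^ (-α)` is Lipschitz on
smaller half-planes, with a constant decaying like `s ^ (-(1 + α))`. -/
theorem norm_sub_le_of_norm_le_rpow_re {u : ℂ → ℂ} {R α C : ℝ} (hR : 0 < R) (hα : 0 < α)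
    (hC : 0 ≤ C) (hd : DifferentiableOn ℂ u {w | R < w.re})
    (hb : ∀ w : ℂ, R < w.re → ‖u w‖ ≤ C * w.re ^ (-α)) {s : ℝ} (hs : 2 * R < s) {w v : ℂ}
    (hw : s ≤ w.re) (hv : s ≤ v.re) :
    ‖u w - u v‖ ≤ C * (s / 2) ^ (-(1 + α)) * ‖w - v‖ := by
  have hs0 : 0 < s / 2 := by linarith
  have hopen : IsOpen {w : ℂ | R < w.re} := isOpen_lt continuous_const Complex.continuous_re
  have hball : ∀ x : ℂ, s ≤ x.re → ∀ z ∈ Metric.closedBall x (s / 2), s / 2 ≤ z.re := by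
    intro x hx z hz
    have h1 := Complex.abs_re_le_norm (z - x)
    rw [Metric.mem_closedBall, dist_eq_norm] at hz
    have h2 := (abs_le.1 (h1.trans hz)).1
    simp only [Complex.sub_re] at h2
    linarith
  have hder : ∀ x ∈ {x : ℂ | s ≤ x.re}, ‖deriv u x‖ ≤ C * (s / 2) ^ (-(1 + α)) := by
    intro x hx
    have key := Complex.norm_deriv_le_of_forall_mem_sphere_norm_le (c := x) (R := s / 2)
      (C := C * (s / 2) ^ (-α)) (f := u) hs0 ?_ ?_
    · refine key.trans (le_of_eq ?_)
      rw [neg_add, add_comm, Real.rpow_add hs0, Real.rpow_neg_one]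
      ring
    · refine DifferentiableOn.diffContOnCl (hd.mono fun z hz => ?_)
      rw [closure_ball _ hs0.ne'] at hz
      have := hball x hx z hz
      simp only [Set.mem_ofPred_eq]
      linarith
    · intro z hz
      have h1 := hball x hx z (Metric.sphere_subset_closedBall hz)
      refine (hb z (by linarith)).trans ?_
      gcongr ?_ * ?_
      exact Real.rpow_le_rpow_of_nonpos hs0 h1 (by linarith)
  refine Convex.norm_image_sub_le_of_norm_deriv_le (s := {x : ℂ | s ≤ x.re}) (fun x hx => ?_) hder
    (convex_halfSpace_re_ge s) hv hw
  exact hd.differentiableAt (hopen.mem_nhds (by simp only [Set.mem_ofPred_eq] at *; linarith))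

/-- If the displacement of `F` along two orbits contracts with summably small constants, then the
difference of the orbits stays close to the initial difference. -/
theorem norm_iterate_sub_iterate_sub_le {F : ℂ → ℂ} {c : ℕ → ℝ} (hc : ∀ k, 0 ≤ c k)
    (hsum : ∀ m, ∑ k ∈ Finset.range m, c k ≤ 1 / 8) {w v : ℂ}
    (h : ∀ k, ‖(F (F^[k] w) - F^[k] w) - (F (F^[k] v) - F^[k] v)‖ ≤ c k * ‖F^[k] w - F^[k] v‖)
    (m : ℕ) :
    ‖(F^[m] w - F^[m] v) - (w - v)‖ ≤ 2 * (∑ k ∈ Finset.range m, c k) * ‖w - v‖ := by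
  induction m with
  | zero => simp
  | succ m ih =>
    have hN := norm_nonneg (w - v)
    have h1 : ‖F^[m] w - F^[m] v‖ ≤ 2 * ‖w - v‖ := by
      have h2 := norm_add_le ((F^[m] w - F^[m] v) - (w - v)) (w - v)
      rw [sub_add_cancel] at h2
      nlinarith [hsum m]
    have h3 := norm_add_le ((F^[m] w - F^[m] v) - (w - v))
      ((F (F^[m] w) - F^[m] w) - (F (F^[m] v) - F^[m] v))
    rw [Finset.sum_range_succ, Function.iterate_succ_apply', Function.iterate_succ_apply']
    have h4 : F (F^[m] w) - F (F^[m] v) - (w - v) = ((F^[m] w - F^[m] v) - (w - v)) +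
      ((F (F^[m] w) - F^[m] w) - (F (F^[m] v) - F^[m] v)) := by ring
    rw [h4]
    nlinarith [h m, hc m]

/-- Existence of an Abel coordinate for a map asymptotic to the unit translation along orbits. -/
theorem exists_abel_coordinate {F : ℂ → ℂ} {H : Set ℂ} (hH : IsOpen H) {c : ℕ → ℝ}
    (hc : ∀ k, 0 ≤ c k) (hcs : Summable c) (hct : ∑' k, c k ≤ 1 / 8) (hFH : Set.MapsTo F H H)
    (hFd : DifferentiableOn ℂ F H)
    (h : ∀ w ∈ H, ∀ v ∈ H, ∀ k,
      ‖(F (F^[k] w) - F^[k] w) - (F (F^[k] v) - F^[k] v)‖ ≤ c k * ‖F^[k] w - F^[k] v‖)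
    (ht : ∀ w ∈ H, Tendsto (fun k => F (F^[k] w) - F^[k] w) atTop (𝓝 1)) {w₀ : ℂ} (hw₀ : w₀ ∈ H) :
    ∃ φ : ℂ → ℂ, DifferentiableOn ℂ φ H ∧ φ w₀ = 0 ∧ (∀ w ∈ H, φ (F w) = φ w + 1) ∧
      ∀ w ∈ H, ∀ v ∈ H, ‖φ w - φ v - (w - v)‖ ≤ 1 / 4 * ‖w - v‖ := by
  have hsum : ∀ m, ∑ k ∈ Finset.range m, c k ≤ 1 / 8 := fun m =>
    (hcs.sum_le_tsum _ fun k _ => hc k).trans hct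
  have hA : ∀ w ∈ H, ∀ v ∈ H, ∀ m, ‖(F^[m] w - F^[m] v) - (w - v)‖ ≤ 1 / 4 * ‖w - v‖ := by
    intro w hw v hv m
    refine (norm_iterate_sub_iterate_sub_le hc hsum (h w hw v hv) m).trans ?_
    nlinarith [hsum m, norm_nonneg (w - v)]
  have hB : ∀ w ∈ H, ∀ m, ‖F^[m] w - F^[m] w₀‖ ≤ 2 * ‖w - w₀‖ := by
    intro w hw m
    have h2 := norm_add_le ((F^[m] w - F^[m] w₀) - (w - w₀)) (w - w₀)
    rw [sub_add_cancel] at h2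
    nlinarith [hA w hw w₀ hw₀ m, norm_nonneg (w - w₀)]
  let T : ℕ → ℂ → ℂ := fun k w => (F (F^[k] w) - F^[k] w) - (F (F^[k] w₀) - F^[k] w₀)
  have hT : ∀ w ∈ H, ∀ k, ‖T k w‖ ≤ c k * (2 * ‖w - w₀‖) := fun w hw k =>
    (h w hw w₀ hw₀ k).trans (mul_le_mul_of_nonneg_left (hB w hw k) (hc k))
  have hpart : ∀ w m, w - w₀ + ∑ k ∈ Finset.range m, T k w = F^[m] w - F^[m] w₀ := by
    intro w m
    induction m with
    | zero => simp
    | succ m ih =>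
      rw [Finset.sum_range_succ, ← add_assoc, ih, Function.iterate_succ_apply',
        Function.iterate_succ_apply']
      simp only [T]
      ring
  let φ : ℂ → ℂ := fun w => w - w₀ + ∑' k, T k w
  have hlim : ∀ w ∈ H, Tendsto (fun m => F^[m] w - F^[m] w₀) atTop (𝓝 (φ w)) := by
    intro w hw
    have hs : Summable fun k => T k w :=
      Summable.of_norm_bounded (hcs.mul_right _) (hT w hw)
    have := (hs.hasSum.tendsto_sum_nat).const_add (w - w₀)
    simpa only [hpart] using this
  have hiter : ∀ k, Set.MapsTo F^[k] H H := fun k => hFH.iterate k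
  refine ⟨φ, ?_, ?_, ?_, ?_⟩
  · intro w hw
    have hUo : IsOpen (H ∩ Metric.ball w₀ (‖w - w₀‖ + 1)) := hH.inter Metric.isOpen_ball
    have hwU : w ∈ H ∩ Metric.ball w₀ (‖w - w₀‖ + 1) :=
      ⟨hw, by rw [Metric.mem_ball, dist_eq_norm]; linarith⟩
    have hd : DifferentiableOn ℂ (fun w => ∑' k, T k w) (H ∩ Metric.ball w₀ (‖w - w₀‖ + 1)) := by
      refine Complex.differentiableOn_tsum_of_summable_norm
        (hcs.mul_right (2 * (‖w - w₀‖ + 1))) (fun k => ?_) hUo fun k z hz => ?_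
      · refine DifferentiableOn.mono ?_ Set.inter_subset_left
        have h1 := hFd.iterate hFH k
        exact ((hFd.comp h1 (hiter k)).sub h1).sub (differentiableOn_const _)
      · refine (hT z hz.1 k).trans (mul_le_mul_of_nonneg_left ?_ (hc k))
        have := hz.2
        rw [Metric.mem_ball, dist_eq_norm] at this
        linarith
    exact ((differentiableAt_id.sub_const w₀).add
      (hd.differentiableAt (hUo.mem_nhds hwU))).differentiableWithinAt
  · simp [φ, T]
  · intro w hw
    have h1 := hlim (F w) (hFH hw)
    have h2 := (hlim w hw).add (ht w hw)
    refine tendsto_nhds_unique h1 (h2.congr fun m => ?_)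
    rw [← Function.iterate_succ_apply, Function.iterate_succ_apply']
    ring
  · intro w hw v hv
    have h1 := ((hlim w hw).sub (hlim v hv)).sub_const (w - v)
    refine le_of_tendsto h1.norm (Eventually.of_forall fun m => ?_)
    have := hA w hw v hv m
    simpa only [sub_sub_sub_cancel_right] using this

/-- The open cone `|Im z| < Re z / 2`. -/
def rightCone : Set ℂ := {z | |z.im| < z.re / 2}

theorem rightCone_re_pos {z : ℂ} (hz : z ∈ rightCone) : 0 < z.re := by
  have h1 : |z.im| < z.re / 2 := hz
  linarith [abs_nonneg z.im]

theorem isOpen_rightCone : IsOpen rightCone :=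
  isOpen_lt Complex.continuous_im.abs (Complex.continuous_re.div_const 2)

theorem add_natCast_mem_rightCone {z : ℂ} (hz : z ∈ rightCone) (m : ℕ) : z + m ∈ rightCone := by
  have h1 : |z.im| < z.re / 2 := hz
  have h2 : (0 : ℝ) ≤ m := m.cast_nonneg
  simp only [rightCone, Set.mem_ofPred_eq, Complex.add_im, Complex.natCast_im, add_zero,
    Complex.add_re, Complex.natCast_re]
  linarith

theorem add_one_mem_rightCone {z : ℂ} (hz : z ∈ rightCone) : z + 1 ∈ rightCone := by
  simpa using add_natCast_mem_rightCone hz 1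

theorem one_mem_rightCone : (1 : ℂ) ∈ rightCone := by
  simp [rightCone]

theorem convex_rightCone : Convex ℝ rightCone := by
  intro x hx y hy a b ha hb hab
  have h1 : |x.im| < x.re / 2 := hx
  have h2 : |y.im| < y.re / 2 := hy
  simp only [rightCone, Set.mem_ofPred_eq, Complex.add_im, Complex.add_re, Complex.real_smul,
    Complex.mul_re, Complex.mul_im, Complex.ofReal_re, Complex.ofReal_im, zero_mul, add_zero,
    sub_zero]
  rw [abs_lt] at *
  rcases ha.eq_or_lt with rfl | ha
  · obtain rfl : b = 1 := by linarith
    constructor <;> linarith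
  · constructor <;> nlinarith

/-- A function on a right half-plane that is close to the identity in the Lipschitz sense has a
holomorphic right inverse on the cone. -/
theorem exists_inverse_on_rightCone {φ : ℂ → ℂ} {R : ℝ} (hd : DifferentiableOn ℂ φ {w | R < w.re})
    (h0 : φ (R + 1 : ℝ) = 0)
    (hφ : ∀ w ∈ {w : ℂ | R < w.re}, ∀ v ∈ {w : ℂ | R < w.re},
      ‖φ w - φ v - (w - v)‖ ≤ 1 / 4 * ‖w - v‖) :
    ∃ χ : ℂ → ℂ, DifferentiableOn ℂ χ rightCone ∧
      (∀ s ∈ rightCone, R < (χ s).re ∧ φ (χ s) = s ∧ ‖s‖ ≤ 5 / 4 * ‖χ s - (R + 1 : ℝ)‖) := by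
  set H : Set ℂ := {w : ℂ | R < w.re} with hHdef
  have hH : IsOpen H := isOpen_lt continuous_const Complex.continuous_re
  have hw₀ : ((R + 1 : ℝ) : ℂ) ∈ H := by simp [hHdef]
  have hsurj : ∀ s ∈ rightCone, ∃ w ∈ H, φ w = s := by
    intro s hs
    have hs1 : |s.im| < s.re / 2 := hs
    have hs0 := rightCone_re_pos hs
    have happ : ApproximatesLinearOn φ ((ContinuousLinearEquiv.refl ℂ ℂ : ℂ ≃L[ℂ] ℂ) : ℂ →L[ℂ] ℂ)
        H (1 / 4) := by
      intro w hw v hv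
      simpa using hφ w hw v hv
    let b : ℂ := ((R + 1 + s.re : ℝ) : ℂ)
    have hb : b ∈ H := by simp only [hHdef, b, Set.mem_ofPred_eq, Complex.ofReal_re]; linarith
    let I : ContinuousLinearMap.NonlinearRightInverse
        ((ContinuousLinearEquiv.refl ℂ ℂ : ℂ ≃L[ℂ] ℂ) : ℂ →L[ℂ] ℂ) :=
      { toFun := id, nnnorm := 1, bound' := by simp, right_inv' := by intro y; simp }
    have hball : Metric.closedBall b s.re ⊆ H := by
      intro z hz
      rw [Metric.mem_closedBall, dist_eq_norm] at hz
      have h1 := (abs_le.1 ((Complex.abs_re_le_norm (z - b)).trans hz)).1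
      simp only [Complex.sub_re, b, Complex.ofReal_re] at h1
      simp only [hHdef, Set.mem_ofPred_eq]
      linarith
    have hsj := happ.surjOn_closedBall_of_nonlinearRightInverse I hs0.le hball
    have hmem : s ∈ Metric.closedBall (φ b) (((I.nnnorm : ℝ)⁻¹ - (1 / 4 : NNReal)) * s.re) := by
      have h1 := hφ b hb _ hw₀
      have h2 : b - ((R + 1 : ℝ) : ℂ) = (s.re : ℂ) := by simp [b]
      rw [h0, h2, sub_zero, Complex.norm_real, Real.norm_of_nonneg hs0.le] at h1
      have h3 : s - (s.re : ℂ) = (s.im : ℂ) * Complex.I := by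
        apply Complex.ext <;> simp
      have h4 : ‖s - (s.re : ℂ)‖ = |s.im| := by rw [h3]; simp
      have h5 := norm_sub_le (s - (s.re : ℂ)) (φ b - (s.re : ℂ))
      rw [sub_sub_sub_cancel_right] at h5
      have h6 : (((I.nnnorm : ℝ)⁻¹ - (1 / 4 : NNReal)) * s.re) = 3 / 4 * s.re := by
        simp only [I]; push_cast; ring
      rw [Metric.mem_closedBall, dist_eq_norm, h6]
      linarith
    obtain ⟨w, hw, rfl⟩ := hsj hmem
    exact ⟨w, hball hw, rfl⟩
  choose! χ hχH hχ using hsurj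
  have hlow : ∀ w ∈ H, ∀ v ∈ H, 3 / 4 * ‖w - v‖ ≤ ‖φ w - φ v‖ := by
    intro w hw v hv
    have h1 := hφ w hw v hv
    have h2 := norm_sub_le (φ w - φ v) (φ w - φ v - (w - v))
    rw [sub_sub_cancel] at h2
    linarith
  refine ⟨χ, fun s hs => ?_, fun s hs => ⟨hχH s hs, hχ s hs, ?_⟩⟩
  · have hnhds : rightCone ∈ 𝓝 s := isOpen_rightCone.mem_nhds hs
    have hda : HasDerivAt φ (deriv φ (χ s)) (χ s) :=
      (hd.differentiableAt (hH.mem_nhds (hχH s hs))).hasDerivAt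
    have hcont : ContinuousAt χ s := by
      rw [Metric.continuousAt_iff']
      intro ε hε
      filter_upwards [hnhds, Metric.ball_mem_nhds s (show 0 < 3 / 4 * ε by positivity)]
        with t ht htb
      have h1 := hlow _ (hχH t ht) _ (hχH s hs)
      rw [hχ t ht, hχ s hs] at h1
      rw [Metric.mem_ball, dist_eq_norm] at htb
      rw [dist_eq_norm]
      linarith
    have hne : deriv φ (χ s) ≠ 0 := by
      intro h
      rw [h] at hda
      have h1 := (hasDerivAt_iff_isLittleO.1 hda).def (show (0 : ℝ) < 1 / 2 by norm_num)
      have h2 : ∀ᶠ w in 𝓝[≠] (χ s), False := by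
        filter_upwards [h1.filter_mono nhdsWithin_le_nhds,
          nhdsWithin_le_nhds (hH.mem_nhds (hχH s hs)), self_mem_nhdsWithin] with w hw hwH hwne
        have h3 := hlow w hwH _ (hχH s hs)
        simp only [smul_zero, sub_zero] at hw
        have h4 : 0 < ‖w - χ s‖ := norm_pos_iff.2 (sub_ne_zero.2 hwne)
        linarith
      exact h2.exists.elim fun _ h => h
    refine (HasDerivAt.of_local_left_inverse hcont hda hne ?_).differentiableAt.differentiableWithinAt
    filter_upwards [hnhds] with t ht using hχ t ht
  · have h1 := hφ _ (hχH s hs) _ hw₀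
    rw [h0, hχ s hs, sub_zero] at h1
    have h2 := norm_add_le (s - (χ s - (R + 1 : ℝ))) (χ s - (R + 1 : ℝ))
    rw [sub_add_cancel] at h2
    linarith

/-- A holomorphic map of a right half-plane with `F w = w + 1 + O((Re w) ^ (-α))` has a Fatou
coordinate `φ` on a smaller half-plane, with a holomorphic right inverse `χ` on the cone. -/
theorem exists_fatou_coordinate {F : ℂ → ℂ} {R₀ α C : ℝ} (hR₀ : 0 < R₀) (hα : 0 < α) (hC : 0 ≤ C)
    (hd : DifferentiableOn ℂ F {w | R₀ < w.re})
    (hb : ∀ w : ℂ, R₀ < w.re → ‖F w - w - 1‖ ≤ C * w.re ^ (-α)) :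
    ∃ R : ℝ, R₀ < R ∧ ∃ φ χ : ℂ → ℂ, DifferentiableOn ℂ φ {w | R < w.re} ∧
      DifferentiableOn ℂ χ rightCone ∧
      ∀ s ∈ rightCone, R < (χ s).re ∧ φ (χ s) = s ∧ F (χ s) = χ (s + 1) ∧
        ‖s‖ ≤ 5 / 4 * ‖χ s - (R + 1 : ℝ)‖ := by
  let d : ℕ → ℝ := fun j => C * ((j : ℝ) / 2 / 2) ^ (-(1 + α))
  have hdsum : Summable d := by
    refine Summable.mul_left _ ?_
    have h1 : Summable fun j : ℕ => (j : ℝ) ^ (-(1 + α)) :=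
      Real.summable_nat_rpow.2 (by linarith)
    refine (h1.mul_right ((4 : ℝ) ^ (-(1 + α)))⁻¹).congr fun j => ?_
    rw [div_div, Real.div_rpow j.cast_nonneg (by norm_num)]
    norm_num [div_eq_mul_inv]
  have hdnn : ∀ j, 0 ≤ d j := fun j => by positivity
  have htail : ∀ᶠ K : ℕ in atTop, ∑' k, d (k + K) ≤ 1 / 8 :=
    (tendsto_sum_nat_add d).eventually_le_const (by norm_num)
  have hhalf : Tendsto (fun K : ℕ => (K : ℝ) / 2) atTop atTop :=
    tendsto_natCast_atTop_atTop.atTop_div_const (by norm_num)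
  have hdecay : Tendsto (fun x : ℝ => C * x ^ (-α)) atTop (𝓝 0) := by
    simpa using (tendsto_rpow_neg_atTop hα).const_mul C
  have hsmall : ∀ᶠ K : ℕ in atTop, C * ((K : ℝ) / 2) ^ (-α) ≤ 1 / 2 :=
    (hdecay.comp hhalf).eventually_le_const (by norm_num)
  obtain ⟨K, hK1, hK2, hK3⟩ :=
    (htail.and (hsmall.and (hhalf.eventually_gt_atTop (2 * R₀)))).exists
  set R : ℝ := (K : ℝ) / 2 with hR
  have hRR₀ : R₀ < R := by linarith
  have hR0 : 0 < R := by linarith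
  set H : Set ℂ := {w : ℂ | R < w.re} with hHdef
  have hHsub : H ⊆ {w : ℂ | R₀ < w.re} := fun w hw => hRR₀.trans hw
  have hstep : ∀ w ∈ H, w.re + 1 / 2 ≤ (F w).re := by
    intro w hw
    have hw' : R < w.re := hw
    have h1 : ‖F w - w - 1‖ ≤ 1 / 2 := by
      refine (hb w (hHsub hw)).trans (le_trans ?_ hK2)
      gcongr ?_ * ?_
      exact Real.rpow_le_rpow_of_nonpos hR0 hw'.le (by linarith)
    have h2 := (abs_le.1 ((Complex.abs_re_le_norm _).trans h1)).1
    simp only [Complex.sub_re, Complex.one_re] at h2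
    linarith
  have hmaps : Set.MapsTo F H H := by
    intro w hw
    have h1 := hstep w hw
    have hw' : R < w.re := hw
    simp only [hHdef, Set.mem_ofPred_eq]
    linarith
  have horbit : ∀ w ∈ H, ∀ k : ℕ, R + (k : ℝ) / 2 ≤ (F^[k] w).re := by
    intro w hw k
    induction k with
    | zero =>
      have hw' : R < w.re := hw
      simpa using hw'.le
    | succ k ih =>
      have h1 := hstep _ (hmaps.iterate k hw)
      rw [Function.iterate_succ_apply']
      push_cast
      linarith
  have hH : IsOpen H := isOpen_lt continuous_const Complex.continuous_re
  have hu : DifferentiableOn ℂ (fun w => F w - w - 1) {w | R₀ < w.re} :=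
    (hd.sub differentiableOn_id).sub (differentiableOn_const _)
  have hw₀ : ((R + 1 : ℝ) : ℂ) ∈ H := by simp [hHdef]
  obtain ⟨φ, hφd, hφ0, hφF, hφL⟩ := exists_abel_coordinate (F := F) (c := fun k => d (k + K)) hH
    (fun k => hdnn _) ((summable_nat_add_iff K).2 hdsum) hK1 hmaps (hd.mono hHsub)
    (fun w hw v hv k => by
      have hk : (((k + K : ℕ) : ℝ)) / 2 = R + (k : ℝ) / 2 := by rw [hR]; push_cast; ring
      have h1 := norm_sub_le_of_norm_le_rpow_re hR₀ hα hC hu hb (s := ((k + K : ℕ) : ℝ) / 2)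
        (w := F^[k] w) (v := F^[k] v)
        (by rw [hk]; have : (0 : ℝ) ≤ k := k.cast_nonneg; linarith)
        (by rw [hk]; exact horbit w hw k) (by rw [hk]; exact horbit v hv k)
      simpa only [sub_sub_sub_cancel_right] using h1)
    (fun w hw => by
      have h1 : Tendsto (fun k : ℕ => R + (k : ℝ) / 2) atTop atTop :=
        tendsto_atTop_add_const_left _ _ hhalf
      have h2 : Tendsto (fun k => (F^[k] w).re) atTop atTop :=
        tendsto_atTop_mono (horbit w hw) h1
      have h3 : Tendsto (fun k => F (F^[k] w) - F^[k] w - 1) atTop (𝓝 0) :=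
        squeeze_zero_norm (fun k => hb _ (hHsub (hmaps.iterate k hw))) (hdecay.comp h2)
      simpa using h3.add_const 1) hw₀
  obtain ⟨χ, hχd, hχ⟩ := exists_inverse_on_rightCone hφd hφ0 hφL
  refine ⟨R, hRR₀, φ, χ, hφd, hχd, fun s hs => ⟨(hχ s hs).1, (hχ s hs).2.1, ?_, (hχ s hs).2.2⟩⟩
  have hs1 := add_one_mem_rightCone hs
  have h1 : φ (F (χ s)) = φ (χ (s + 1)) := by
    rw [hφF _ (hχ s hs).1, (hχ s hs).2.1, (hχ _ hs1).2.1]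
  have h2 := hφL _ (hmaps (hχ s hs).1) _ (hχ _ hs1).1
  rw [h1, sub_self, zero_sub, norm_neg] at h2
  have h3 := norm_nonneg (F (χ s) - χ (s + 1))
  exact sub_eq_zero.1 (norm_eq_zero.1 (by linarith))

/-- An analytic function that is `o(z ^ m)` at `0` is divisible by `z ^ (m + 1)`. -/
theorem AnalyticAt.exists_eq_pow_succ_mul_of_isLittleO {h : ℂ → ℂ} {m : ℕ} (hh : AnalyticAt ℂ h 0)
    (ho : h =o[𝓝 (0 : ℂ)] fun z : ℂ => z ^ m) :
    ∃ g : ℂ → ℂ, AnalyticAt ℂ g 0 ∧ ∀ᶠ z in 𝓝 (0 : ℂ), h z = z ^ (m + 1) * g z := by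
  suffices hle : ((m + 1 : ℕ) : ℕ∞) ≤ analyticOrderAt h 0 by
    simpa using (natCast_le_analyticOrderAt hh).1 hle
  by_contra hlt
  rw [not_le] at hlt
  obtain ⟨k, hk⟩ := ENat.ne_top_iff_exists.1 hlt.ne_top
  rw [← hk, Nat.cast_lt] at hlt
  obtain ⟨g, hg, hg0, hhg⟩ := hh.analyticOrderAt_eq_natCast.1 hk.symm
  have h1 : (fun z : ℂ => z ^ m) =O[𝓝 (0 : ℂ)] fun z : ℂ => z ^ k := by
    refine IsBigO.of_bound 1 ?_
    filter_upwards [Metric.closedBall_mem_nhds (0 : ℂ) one_pos] with z hz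
    rw [one_mul, norm_pow, norm_pow]
    exact pow_le_pow_of_le_one (norm_nonneg z) (by simpa using hz) (by omega)
  have h2 := (ho.trans_isBigO h1).def (show 0 < ‖g 0‖ / 2 by positivity)
  have h3 : ∀ᶠ z in 𝓝 (0 : ℂ), ‖g 0‖ / 2 < ‖g z‖ :=
    hg.continuousAt.norm.eventually_const_lt (by linarith [norm_pos_iff.2 hg0])
  have h4 : ∀ᶠ z in 𝓝[≠] (0 : ℂ), False := by
    filter_upwards [nhdsWithin_le_nhds h2, nhdsWithin_le_nhds h3, nhdsWithin_le_nhds hhg,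
      self_mem_nhdsWithin] with z hz2 hz3 hz hz0
    rw [hz, sub_zero, smul_eq_mul, norm_mul, mul_comm] at hz2
    have : 0 < ‖z ^ k‖ := norm_pos_iff.2 (pow_ne_zero _ hz0)
    exact absurd (le_of_mul_le_mul_right hz2 this) (not_le.2 hz3)
  exact h4.exists.elim fun _ h => h

/-- Local estimates for a normalized parabolic germ. -/
theorem exists_parabolic_germ_bounds {n : ℕ} (hn : 1 ≤ n) {f : ℂ → ℂ} {N : Set ℂ}
    (hN : N ∈ 𝓝 (0 : ℂ)) (hfd : DifferentiableOn ℂ f N)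
    (hfexp : (fun z : ℂ => f z - z * (1 + z ^ n)) =o[𝓝 (0 : ℂ)] fun z : ℂ => z ^ (n + 1)) :
    ∃ δ > 0, ∃ C ≥ 0, ∀ z : ℂ, ‖z‖ < δ → z ∈ N ∩ f '' N ∧ DifferentiableAt ℂ f z ∧
      (z ≠ 0 → f z ≠ 0 ∧ |(z / f z).arg| < Real.pi / (2 * n) ∧
        ‖(z / f z) ^ n - 1 + n * z ^ n‖ ≤ C * ‖z‖ ^ (n + 1)) := by
  have hfa : AnalyticAt ℂ f 0 := hfd.analyticAt hN
  have hrem : AnalyticAt ℂ (fun z : ℂ => f z - z * (1 + z ^ n)) 0 := by fun_prop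
  obtain ⟨g, hg, hfg⟩ := hrem.exists_eq_pow_succ_mul_of_isLittleO hfexp
  let p : ℂ → ℂ := fun z => z ^ n + z ^ (n + 1) * g z
  have hp : AnalyticAt ℂ p 0 := by fun_prop
  have hp0 : p 0 = 0 := by simp [p]; omega
  have hfp : ∀ᶠ z in 𝓝 (0 : ℂ), f z = z * (1 + p z) := by
    filter_upwards [hfg] with z hz
    rw [sub_eq_iff_eq_add] at hz
    rw [hz]
    simp only [p]
    ring
  have hf0 : f 0 = 0 := by simpa using hfp.self_of_nhds
  have hderiv : HasStrictDerivAt f 1 0 := by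
    have h1 : HasDerivAt f 1 0 := by
      have h2 : HasDerivAt (fun z => z * (1 + p z)) (1 * (1 + p 0) + 0 * deriv p 0) 0 :=
        (hasDerivAt_id (0 : ℂ)).mul (hp.differentiableAt.hasDerivAt.const_add 1)
      rw [hp0] at h2
      simpa using h2.congr_of_eventuallyEq hfp
    have h3 := hfa.hasStrictDerivAt
    rwa [h1.deriv] at h3
  have himage : f '' N ∈ 𝓝 (0 : ℂ) := by
    have h1 := hderiv.map_nhds_eq one_ne_zero
    rw [hf0] at h1
    rw [← h1]
    exact image_mem_map hN
  let E : ℂ → ℂ := fun z => ((1 + p z)⁻¹) ^ n - 1 + n * z ^ n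
  have hinv : AnalyticAt ℂ (fun z => (1 + p z)⁻¹) 0 :=
    (analyticAt_const.add hp).inv (by simp [hp0])
  have hE : AnalyticAt ℂ E 0 := by fun_prop
  have hzO : ∀ a : ℂ → ℂ, ContinuousAt a 0 →
      (fun z : ℂ => z ^ (n + 1) * a z) =o[𝓝 (0 : ℂ)] fun z : ℂ => z ^ n := by
    intro a ha
    have h1 : (fun z : ℂ => z * a z) =o[𝓝 (0 : ℂ)] fun _ => (1 : ℂ) := by
      rw [isLittleO_one_iff]
      have h2 : ContinuousAt (fun z : ℂ => z * a z) 0 := continuousAt_id.mul ha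
      simpa using h2.tendsto
    simpa only [pow_succ, mul_assoc, mul_one] using
      (isBigO_refl (fun z : ℂ => z ^ n) (𝓝 0)).mul_isLittleO h1
  have hEo : E =o[𝓝 (0 : ℂ)] fun z : ℂ => z ^ n := by
    have hk : HasDerivAt (fun y : ℂ => ((1 + y)⁻¹) ^ n) (-(n : ℂ)) 0 := by
      have h1 : HasDerivAt (fun y : ℂ => (1 + y)⁻¹) (-1 / (1 + 0) ^ 2) (0 : ℂ) :=
        ((hasDerivAt_id (0 : ℂ)).const_add 1).inv (by simp)
      exact (h1.fun_pow n).congr_deriv (by simp)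
    have hko := hk.isLittleO
    have hpt : Tendsto p (𝓝 0) (𝓝 0) := by simpa [hp0] using hp.continuousAt.tendsto
    have h2 := hko.comp_tendsto hpt
    have hpO : p =O[𝓝 (0 : ℂ)] fun z : ℂ => z ^ n :=
      (isBigO_refl _ _).add (hzO g hg.continuousAt).isBigO
    have h3 : (fun z => ((1 + p z)⁻¹) ^ n - 1 + n * p z) =o[𝓝 (0 : ℂ)] fun z : ℂ => z ^ n := by
      refine IsLittleO.trans_isBigO ?_ hpO
      refine (h2.congr (fun z => ?_) fun z => ?_)
      · simp [mul_comm]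
      · simp
    have h4 := h3.sub (hzO (fun z => n * g z) (by
      have := hg.continuousAt
      fun_prop))
    refine h4.congr_left fun z => ?_
    simp only [E, p]
    ring
  obtain ⟨b, hb, hEb⟩ := hE.exists_eq_pow_succ_mul_of_isLittleO hEo
  have hbb : ∀ᶠ z in 𝓝 (0 : ℂ), ‖b z‖ < ‖b 0‖ + 1 :=
    hb.continuousAt.norm.eventually_lt_const (by linarith)
  have hn0 : (0 : ℝ) < n := by exact_mod_cast hn
  have harg : ∀ᶠ z in 𝓝 (0 : ℂ), |((1 + p z)⁻¹).arg| < Real.pi / (2 * n) := by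
    have h1 : ContinuousAt (fun z => |((1 + p z)⁻¹).arg|) 0 := by
      refine (ContinuousAt.comp' (g := Complex.arg) ?_ hinv.continuousAt).abs
      exact Complex.continuousAt_arg (by simp [hp0])
    refine h1.eventually_lt_const ?_
    have := Real.pi_pos
    simp only [hp0, add_zero, inv_one, Complex.arg_one, abs_zero]
    positivity
  have hne : ∀ᶠ z in 𝓝 (0 : ℂ), 1 + p z ≠ 0 :=
    (continuousAt_const.add hp.continuousAt).eventually_ne (by simp [hp0])
  have hdiff : ∀ᶠ z in 𝓝 (0 : ℂ), DifferentiableAt ℂ f z :=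
    hfa.eventually_analyticAt.mono fun z hz => hz.differentiableAt
  have hmem : ∀ᶠ z in 𝓝 (0 : ℂ), z ∈ N ∩ f '' N := inter_mem hN himage
  obtain ⟨δ, hδ, hall⟩ := Metric.eventually_nhds_iff.1
    (hmem.and (hdiff.and (hfp.and (hEb.and (hbb.and (harg.and hne))))))
  refine ⟨δ, hδ, ‖b 0‖ + 1, by positivity, fun z hz => ?_⟩
  obtain ⟨h1, h2, h3, h4, h5, h6, h7⟩ := hall (show dist z 0 < δ by simpa using hz)
  refine ⟨h1, h2, fun hz0 => ?_⟩
  have hq : z / f z = (1 + p z)⁻¹ := by rw [h3]; field_simp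
  refine ⟨by rw [h3]; exact mul_ne_zero hz0 h7, by rwa [hq], ?_⟩
  have h8 : (z / f z) ^ n - 1 + n * z ^ n = z ^ (n + 1) * b z := by rw [hq, ← h4]
  rw [h8, norm_mul, norm_pow, mul_comm]
  gcongr

/-- Assemble an attracting petal from an injective linearizing parametrization of the cone. -/
theorem isAttractingPetal_image_rightCone {f Θ Φ : ℂ → ℂ} {N : Set ℂ}
    (hΘ : DifferentiableOn ℂ Θ rightCone) (hΦΘ : ∀ s ∈ rightCone, Φ (Θ s) = s)
    (hΦ : ∀ s ∈ rightCone, DifferentiableAt ℂ Φ (Θ s))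
    (hN : ∀ s ∈ rightCone, Θ s ∈ N ∩ f '' N) (h0 : ∀ s ∈ rightCone, Θ s ≠ 0)
    (hf : ∀ s ∈ rightCone, f (Θ s) = Θ (s + 1))
    (hlim : ∀ ε > 0, ∃ T : ℝ, ∀ s ∈ rightCone, T < s.re → ‖Θ s‖ < ε) :
    IsAttractingPetal f N (Θ '' rightCone) := by
  have hiter : ∀ s ∈ rightCone, ∀ m : ℕ, f^[m] (Θ s) = Θ (s + m) := by
    intro s hs m
    induction m with
    | zero => simp
    | succ m ih =>
      rw [Function.iterate_succ_apply', ih, hf _ (add_natCast_mem_rightCone hs m)]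
      push_cast
      rw [add_assoc]
  refine ⟨⟨Θ 1, 1, one_mem_rightCone, rfl⟩, ?_, ?_, ?_, ?_, ?_, ?_, ?_⟩
  · rw [isOpen_iff_mem_nhds]
    rintro _ ⟨s, hs, rfl⟩
    have hnhds := isOpen_rightCone.mem_nhds hs
    have hst : HasStrictDerivAt Θ (deriv Θ s) s := (hΘ.analyticAt hnhds).hasStrictDerivAt
    have hne : deriv Θ s ≠ 0 := by
      intro h
      have h1 := (hΦ s hs).hasDerivAt.comp s hst.hasDerivAt
      have h2 : HasDerivAt (Φ ∘ Θ) 1 s := (hasDerivAt_id s).congr_of_eventuallyEq <| by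
        filter_upwards [hnhds] with t ht using hΦΘ t ht
      have h3 := h1.unique h2
      simp [h] at h3
    rw [← hst.map_nhds_eq hne]
    exact image_mem_map hnhds
  · have hc : ContractibleSpace rightCone :=
      convex_rightCone.contractibleSpace ⟨1, one_mem_rightCone⟩
    let e : (Θ '' rightCone : Set ℂ) ≃ₜ rightCone :=
      { toFun := fun z => ⟨Φ z, by
          obtain ⟨_, s, hs, rfl⟩ := z
          simpa only [hΦΘ s hs] using hs⟩
        invFun := fun s => ⟨Θ s, s, s.2, rfl⟩
        left_inv := by
          rintro ⟨_, s, hs, rfl⟩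
          simp [hΦΘ s hs]
        right_inv := by
          rintro ⟨s, hs⟩
          simp [hΦΘ s hs]
        continuous_toFun := by
          refine Continuous.subtype_mk ?_ _
          refine continuous_iff_continuousAt.2 ?_
          rintro ⟨_, s, hs, rfl⟩
          exact (hΦ s hs).continuousAt.comp (f := Subtype.val) continuousAt_subtype_val
        continuous_invFun :=
          (continuousOn_iff_continuous_domRestrict.1 hΘ.continuousOn).subtype_mk _ }
    have := e.contractibleSpace
    infer_instance
  · rintro _ ⟨s, hs, rfl⟩
    exact hN s hs
  · rintro _ ⟨_, ⟨s, hs, rfl⟩, rfl⟩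
    exact ⟨s + 1, add_one_mem_rightCone hs, (hf s hs).symm⟩
  · rw [Metric.mem_closure_iff]
    intro ε hε
    obtain ⟨T, hT⟩ := hlim ε hε
    obtain ⟨m, hm⟩ := exists_nat_gt T
    have hmem := add_natCast_mem_rightCone one_mem_rightCone m
    refine ⟨_, ⟨_, hmem, rfl⟩, ?_⟩
    rw [dist_zero_left]
    refine hT _ hmem ?_
    simp
    linarith
  · rintro ⟨s, hs, h⟩
    exact h0 s hs h
  · rw [Metric.tendstoUniformlyOn_iff]
    intro ε hε
    obtain ⟨T, hT⟩ := hlim ε hε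
    obtain ⟨M, hM⟩ := exists_nat_gt T
    filter_upwards [eventually_ge_atTop M] with m hm
    rintro _ ⟨s, hs, rfl⟩
    rw [dist_zero_left, hiter s hs]
    refine hT _ (add_natCast_mem_rightCone hs m) ?_
    have h1 := rightCone_re_pos hs
    have h2 : (M : ℝ) ≤ m := by exact_mod_cast hm
    simp
    linarith

/-- The argument of the principal `n`-th root of a point in the right half-plane. -/
theorem abs_arg_cpow_natCast_inv_lt {n : ℕ} (hn : 1 ≤ n) {w : ℂ} (hw : 0 < w.re) :
    |(w ^ ((n : ℂ)⁻¹)).arg| < Real.pi / (2 * n) := by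
  have hw0 : w ≠ 0 := by rintro rfl; simp at hw
  have hn0 : (0 : ℝ) < n := by exact_mod_cast hn
  have hn1 : (1 : ℝ) ≤ n := by exact_mod_cast hn
  have h1 : |w.arg| < Real.pi / 2 := Complex.abs_arg_lt_pi_div_two_iff.2 (Or.inl hw)
  have h2 : (Complex.log w * (n : ℂ)⁻¹).im = w.arg / n := by
    have h3 : ((n : ℂ)⁻¹) = (((n : ℝ)⁻¹ : ℝ) : ℂ) := by push_cast; rfl
    rw [h3, mul_comm, Complex.im_ofReal_mul, Complex.log_im, div_eq_inv_mul]
  have h4 : |w.arg / n| < Real.pi / (2 * n) := by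
    rw [abs_div, abs_of_pos hn0, ← div_div]
    gcongr
  have h5 : Real.pi / (2 * n) ≤ Real.pi := by
    refine div_le_self Real.pi_pos.le (by linarith)
  obtain ⟨h6, h7⟩ := abs_lt.1 h4
  rw [Complex.cpow_def_of_ne_zero hw0, ← Complex.log_im, Complex.log_exp, h2]
  · exact h4
  · rw [h2]; linarith
  · rw [h2]; linarith

/-- A normalized parabolic germ has an attracting petal, parametrized by the cone, on which it is
conjugate to the unit translation. -/
theorem exists_petal_parametrization {n : ℕ} (hn : 1 ≤ n) {f : ℂ → ℂ} {N : Set ℂ}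
    (hN : N ∈ 𝓝 (0 : ℂ)) (hfd : DifferentiableOn ℂ f N)
    (hfexp : (fun z : ℂ => f z - z * (1 + z ^ n)) =o[𝓝 (0 : ℂ)] fun z : ℂ => z ^ (n + 1)) :
    ∃ Θ Φ : ℂ → ℂ, DifferentiableOn ℂ Θ rightCone ∧ IsAttractingPetal f N (Θ '' rightCone) ∧
      ∀ s ∈ rightCone, Φ (Θ s) = s ∧ DifferentiableAt ℂ Φ (Θ s) ∧ f (Θ s) = Θ (s + 1) := by
  obtain ⟨δ, hδ, C, hC, hloc⟩ := exists_parabolic_germ_bounds hn hN hfd hfexp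
  have hn' : n ≠ 0 := by omega
  have hn0 : (0 : ℝ) < n := by exact_mod_cast hn
  have hn1 : (1 : ℝ) ≤ n := by exact_mod_cast hn
  obtain ⟨κ, hκ⟩ := IsAlgClosed.exists_pow_nat_eq (-(n : ℂ)⁻¹) (show 0 < n by omega)
  have hκ0 : κ ≠ 0 := by
    rintro rfl
    rw [zero_pow hn'] at hκ
    simp [hn'] at hκ
  let Z : ℂ → ℂ := fun w => κ / w ^ ((n : ℂ)⁻¹)
  have hne : ∀ w : ℂ, 0 < w.re → w ≠ 0 := by
    rintro w hw rfl
    simp at hw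
  have hroot : ∀ w : ℂ, 0 < w.re → w ^ ((n : ℂ)⁻¹) ≠ 0 := fun w hw h =>
    hne w hw (by rw [← Complex.cpow_nat_inv_pow w hn', h, zero_pow hn'])
  have hZ0 : ∀ w : ℂ, 0 < w.re → Z w ≠ 0 := fun w hw => div_ne_zero hκ0 (hroot w hw)
  have hZn : ∀ w : ℂ, (Z w) ^ n = -(n : ℂ)⁻¹ / w := fun w => by
    simp only [Z, div_pow, hκ, Complex.cpow_nat_inv_pow w hn']
  have hZnorm : ∀ w : ℂ, 0 < w.re → ‖Z w‖ = ‖κ‖ * ‖w‖ ^ (-(n : ℝ)⁻¹) := by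
    intro w hw
    have h3 : ((n : ℂ)⁻¹) = (((n : ℝ)⁻¹ : ℝ) : ℂ) := by push_cast; rfl
    rw [norm_div, h3, Complex.norm_cpow_real, Real.rpow_neg (norm_nonneg _), div_eq_mul_inv]
  have hZd : ∀ w : ℂ, 0 < w.re → DifferentiableAt ℂ Z w := fun w hw =>
    (differentiableAt_const κ).div
      (differentiableAt_id.cpow_const (Or.inl hw)) (hroot w hw)
  have hα : (0 : ℝ) < (n : ℝ)⁻¹ := by positivity
  have hdecay : Tendsto (fun x : ℝ => ‖κ‖ * x ^ (-(n : ℝ)⁻¹)) atTop (𝓝 0) := by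
    simpa using (tendsto_rpow_neg_atTop hα).const_mul ‖κ‖
  have hZlim : ∀ ε > 0, ∃ M > 0, ∀ w : ℂ, 0 < w.re → M < ‖w‖ → ‖Z w‖ < ε := by
    intro ε hε
    obtain ⟨M, hM, hM0⟩ := ((hdecay.eventually_lt_const hε).and (eventually_gt_atTop 0)).exists
    refine ⟨M, hM0, fun w hw hMw => ?_⟩
    rw [hZnorm w hw]
    refine lt_of_le_of_lt ?_ hM
    gcongr ?_ * ?_
    exact Real.rpow_le_rpow_of_nonpos hM0 hMw.le (by linarith)
  obtain ⟨R₀, hR₀, hR₀Z⟩ := hZlim δ hδ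
  have hZδ : ∀ w : ℂ, R₀ < w.re → ‖Z w‖ < δ := fun w hw =>
    hR₀Z w (hR₀.trans hw) (hw.trans_le (Complex.re_le_norm w))
  let F : ℂ → ℂ := fun w => (κ / f (Z w)) ^ n
  have hFq : ∀ w : ℂ, R₀ < w.re → κ / f (Z w) = w ^ ((n : ℂ)⁻¹) * (Z w / f (Z w)) := by
    intro w hw
    have h1 := hroot w (hR₀.trans hw)
    have h2 : w ^ ((n : ℂ)⁻¹) * Z w = κ := mul_div_cancel₀ κ h1
    rw [← mul_div_assoc, h2]
  have hFd : DifferentiableOn ℂ F {w | R₀ < w.re} := by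
    intro w hw
    have hw0 : 0 < w.re := hR₀.trans hw
    obtain ⟨-, h1, h2⟩ := hloc (Z w) (hZδ w hw)
    have h3 : DifferentiableAt ℂ (fun w => f (Z w)) w := h1.comp w (hZd w hw0)
    exact (((differentiableAt_const κ).div h3 (h2 (hZ0 w hw0)).1).pow n).differentiableWithinAt
  have hFb : ∀ w : ℂ, R₀ < w.re → ‖F w - w - 1‖ ≤ C * ‖κ‖ * w.re ^ (-(n : ℝ)⁻¹) := by
    intro w hw
    have hw0 : 0 < w.re := hR₀.trans hw
    obtain ⟨-, -, h2⟩ := hloc (Z w) (hZδ w hw)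
    obtain ⟨-, -, h3⟩ := h2 (hZ0 w hw0)
    have h4 : F w - w - 1 = w * ((Z w / f (Z w)) ^ n - 1 + n * (Z w) ^ n) := by
      simp only [F, hFq w hw, mul_pow, Complex.cpow_nat_inv_pow w hn', hZn]
      have := hne w hw0
      field_simp
      ring
    have h5 : ‖w‖ * ‖Z w‖ ^ n ≤ 1 := by
      rw [← norm_pow, ← norm_mul, hZn, mul_div_cancel₀ _ (hne w hw0), norm_neg, norm_inv,
        Complex.norm_natCast]
      exact inv_le_one_of_one_le₀ hn1
    have h6 : ‖Z w‖ ≤ ‖κ‖ * w.re ^ (-(n : ℝ)⁻¹) := by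
      rw [hZnorm w hw0]
      gcongr ?_ * ?_
      exact Real.rpow_le_rpow_of_nonpos hw0 (Complex.re_le_norm w) (by linarith)
    rw [h4, norm_mul]
    calc ‖w‖ * ‖(Z w / f (Z w)) ^ n - 1 + n * (Z w) ^ n‖
        ≤ ‖w‖ * (C * ‖Z w‖ ^ (n + 1)) := by gcongr
      _ = C * ((‖w‖ * ‖Z w‖ ^ n) * ‖Z w‖) := by ring
      _ ≤ C * (1 * (‖κ‖ * w.re ^ (-(n : ℝ)⁻¹))) := by gcongr
      _ = C * ‖κ‖ * w.re ^ (-(n : ℝ)⁻¹) := by ring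
  have hZF : ∀ w : ℂ, R₀ < w.re → Z (F w) = f (Z w) := by
    intro w hw
    have hw0 : 0 < w.re := hR₀.trans hw
    obtain ⟨-, -, h2⟩ := hloc (Z w) (hZδ w hw)
    obtain ⟨h3, h4, -⟩ := h2 (hZ0 w hw0)
    have h5 := abs_lt.1 (abs_arg_cpow_natCast_inv_lt hn hw0)
    have h4' := abs_lt.1 h4
    have h6 : Real.pi / (2 * n) + Real.pi / (2 * n) = Real.pi / n := by
      field_simp
      norm_num
    have h7 : Real.pi / n ≤ Real.pi := div_le_self Real.pi_pos.le hn1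
    have h8 : (w ^ ((n : ℂ)⁻¹) * (Z w / f (Z w))).arg =
        (w ^ ((n : ℂ)⁻¹)).arg + (Z w / f (Z w)).arg :=
      Complex.arg_mul (hroot w hw0) (div_ne_zero (hZ0 w hw0) h3)
        ⟨by linarith, by linarith⟩
    have h9 : (F w) ^ ((n : ℂ)⁻¹) = κ / f (Z w) := by
      simp only [F]
      rw [hFq w hw]
      exact Complex.pow_cpow_nat_inv hn' (by rw [h8]; linarith) (by rw [h8]; linarith)
    change κ / (F w) ^ ((n : ℂ)⁻¹) = f (Z w)
    rw [h9, div_div_cancel₀ hκ0]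
  obtain ⟨R, hR, φ, χ, hφd, hχd, hχ⟩ :=
    exists_fatou_coordinate hR₀ hα (by positivity) hFd hFb
  have hpos : ∀ s ∈ rightCone, 0 < (χ s).re := fun s hs => by linarith [(hχ s hs).1]
  have hback : ∀ w : ℂ, 0 < w.re → (κ / Z w) ^ n = w := fun w hw => by
    rw [div_pow, hZn, hκ]
    have := hne w hw
    field_simp
  have hΘd : DifferentiableOn ℂ (fun s => Z (χ s)) rightCone := fun s hs =>
    (hZd _ (hpos s hs)).comp_differentiableWithinAt s (hχd s hs)
  have hΦΘ : ∀ s ∈ rightCone, φ ((κ / Z (χ s)) ^ n) = s := fun s hs => by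
    rw [hback _ (hpos s hs), (hχ s hs).2.1]
  have hΦd : ∀ s ∈ rightCone, DifferentiableAt ℂ (fun z => φ ((κ / z) ^ n)) (Z (χ s)) := by
    intro s hs
    have hopen : IsOpen {w : ℂ | R < w.re} := isOpen_lt continuous_const Complex.continuous_re
    have h1 : DifferentiableAt ℂ φ ((κ / Z (χ s)) ^ n) := by
      rw [hback _ (hpos s hs)]
      exact hφd.differentiableAt (hopen.mem_nhds (hχ s hs).1)
    have h2 : DifferentiableAt ℂ (fun z : ℂ => (κ / z) ^ n) (Z (χ s)) :=
      ((differentiableAt_const κ).div differentiableAt_id (hZ0 _ (hpos s hs))).pow n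
    exact h1.comp (Z (χ s)) h2
  have hconj : ∀ s ∈ rightCone, f (Z (χ s)) = Z (χ (s + 1)) := fun s hs => by
    rw [← (hχ s hs).2.2.1, hZF _ (hR.trans (hχ s hs).1)]
  refine ⟨fun s => Z (χ s), fun z => φ ((κ / z) ^ n), hΘd, ?_, fun s hs =>
    ⟨hΦΘ s hs, hΦd s hs, hconj s hs⟩⟩
  refine isAttractingPetal_image_rightCone hΘd hΦΘ hΦd
    (fun s hs => (hloc _ (hZδ _ (hR.trans (hχ s hs).1))).1) (fun s hs => hZ0 _ (hpos s hs)) hconj ?_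
  intro ε hε
  obtain ⟨M, -, hM⟩ := hZlim ε hε
  refine ⟨5 / 4 * (M + ‖((R + 1 : ℝ) : ℂ)‖), fun s hs hsT => hM _ (hpos s hs) ?_⟩
  have h1 := (hχ s hs).2.2.2
  have h2 := norm_sub_le (χ s) ((R + 1 : ℝ) : ℂ)
  linarith [Complex.re_le_norm s]

/-- Two normalized parabolic germs of multiplicity `n + 1` are conformally
conjugate on suitable attracting petals. -/
theorem conformal_conjugacy_on_petals (n : ℕ) (hn : 1 ≤ n)
    (f g : ℂ → ℂ) (Nf Ng : Set ℂ) (hNf : Nf ∈ 𝓝 (0 : ℂ)) (hNg : Ng ∈ 𝓝 (0 : ℂ))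
    (hfd : DifferentiableOn ℂ f Nf) (hfinj : Set.InjOn f Nf)
    (hfexp : (fun z : ℂ => f z - z * (1 + z ^ n)) =o[𝓝 (0 : ℂ)]
      fun z : ℂ => z ^ (n + 1))
    (hgd : DifferentiableOn ℂ g Ng) (hginj : Set.InjOn g Ng)
    (hgexp : (fun z : ℂ => g z - z * (1 + z ^ n)) =o[𝓝 (0 : ℂ)]
      fun z : ℂ => z ^ (n + 1)) :
    ∃ (Pg Pf : Set ℂ) (ψ : ℂ → ℂ),
      IsAttractingPetal g Ng Pg ∧ IsAttractingPetal f Nf Pf ∧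
      DifferentiableOn ℂ ψ Pg ∧ Set.BijOn ψ Pg Pf ∧
      ∀ z ∈ Pg, f (ψ z) = ψ (g z) := by
  obtain ⟨Θf, Φf, hΘf, hPf, hf⟩ := exists_petal_parametrization hn hNf hfd hfexp
  obtain ⟨Θg, Φg, -, hPg, hg⟩ := exists_petal_parametrization hn hNg hgd hgexp
  refine ⟨_, _, fun z => Θf (Φg z), hPg, hPf, ?_, ⟨?_, ?_, ?_⟩, ?_⟩
  · rintro _ ⟨s, hs, rfl⟩
    have h1 : DifferentiableAt ℂ Θf (Φg (Θg s)) := by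
      rw [(hg s hs).1]
      exact hΘf.differentiableAt (isOpen_rightCone.mem_nhds hs)
    exact (h1.comp (Θg s) (hg s hs).2.1).differentiableWithinAt
  · rintro _ ⟨s, hs, rfl⟩
    exact ⟨s, hs, by simp only [(hg s hs).1]⟩
  · rintro _ ⟨s, hs, rfl⟩ _ ⟨t, ht, rfl⟩ hst
    simp only [(hg s hs).1, (hg t ht).1] at hst
    rw [← (hf s hs).1, hst, (hf t ht).1]
  · rintro _ ⟨s, hs, rfl⟩
    exact ⟨Θg s, ⟨s, hs, rfl⟩, by simp only [(hg s hs).1]⟩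
  · rintro _ ⟨s, hs, rfl⟩
    simp only [(hg s hs).1, (hg s hs).2.2, (hg _ (add_one_mem_rightCone hs)).1, (hf s hs).2.2]
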